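/- arXiv:1411.0398 — 2 statements merged into one kernel-verified Lean document; each statement's English description precedes it below -/
import Mathlib

section
/- Consider on the region D = {(t,x,y,z) ∈ ℝ⁴ : 0 < t < π/2} the conformally flat Bianchi I metric g = diag(−1, sin²t, cos²t, 1). For each choice of signs ε₁, ε₂ ∈ {−1, +1}, the vector field Ȳ with components e^{ε₁ x + ε₂ y} (1, −ε₁ cot t, ε₂ tan t, 0) is a Killing vector of g on D: for all i,j, ξ^k ∂_k g_{ij} + g_{kj} ∂_i ξ^k + g_{ik} ∂_j ξ^k = 0 with ξ = Ȳ. (These are the four extra Killing vectors Ȳ⁴ = e^{x+y}(∂_t − cot t ∂_x + tan t ∂_y), Ȳ⁵ = e^{x−y}(∂_t − cot t ∂_x − tan t ∂_y), Ȳ⁶ = e^{−x+y}(∂_t + cot t ∂_x + tan t ∂_y), Ȳ⁷ = e^{−x−y}(∂_t + cot t ∂_x − tan t ∂_y).) -/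
open Real

/-- Directional (partial) derivative along coordinate `k` on ℝ⁴. -/
noncomputable def pd (k : Fin 4) (f : (Fin 4 → ℝ) → ℝ) (p : Fin 4 → ℝ) : ℝ :=
  fderiv ℝ f p (Pi.single k 1)

/-- Components of the conformally flat Bianchi I metric `diag(−1, sin²t, cos²t, 1)`. -/
noncomputable def gmet (p : Fin 4 → ℝ) (i j : Fin 4) : ℝ :=
  if i = j then
    (![(-1 : ℝ), (Real.sin (p 0)) ^ 2, (Real.cos (p 0)) ^ 2, 1] : Fin 4 → ℝ) i
  else 0

/-- The vector fields `Ȳ = e^{ε₁x+ε₂y}(∂_t − ε₁ cot t ∂_x + ε₂ tan t ∂_y)`. -/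
noncomputable def Ybar (ε₁ ε₂ : ℝ) (q : Fin 4 → ℝ) : Fin 4 → ℝ :=
  fun k => Real.exp (ε₁ * q 1 + ε₂ * q 2) *
    (![(1 : ℝ), -(ε₁ * Real.cot (q 0)), ε₂ * Real.tan (q 0), 0] : Fin 4 → ℝ) k

theorem pd_aux (a b : ℝ) (h : ℝ → ℝ) (h' : ℝ) (p : Fin 4 → ℝ) (hh : HasDerivAt h h' (p 0))
    (k : Fin 4) :
    pd k (fun q => Real.exp (a * q 1 + b * q 2) * h (q 0)) p
      = Real.exp (a * p 1 + b * p 2) *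
        ((![h', a * h (p 0), b * h (p 0), 0] : Fin 4 → ℝ) k) := by
  have e (i : Fin 4) : HasFDerivAt (fun q : Fin 4 → ℝ => q i)
      (ContinuousLinearMap.proj (R := ℝ) (φ := fun _ : Fin 4 => ℝ) i) p := hasFDerivAt_apply i p
  have h1 := (((e 1).const_mul a).add ((e 2).const_mul b)).exp
  have h2 : HasFDerivAt (fun q : Fin 4 → ℝ => h (q 0)) _ p := hh.comp_hasFDerivAt p (e 0)
  have h3 := h1.mul h2
  unfold pd
  erw [h3.fderiv]
  fin_cases k <;> simp <;> ring

theorem pd_aux0 (h : ℝ → ℝ) (h' : ℝ) (p : Fin 4 → ℝ) (hh : HasDerivAt h h' (p 0))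
    (k : Fin 4) :
    pd k (fun q => h (q 0)) p = (![h', 0, 0, 0] : Fin 4 → ℝ) k := by
  have := pd_aux 0 0 h h' p hh k
  simpa using this

/-- for each choice of signs `ε₁, ε₂ ∈ {−1, +1}`, the vector field
`Ȳ = e^{ε₁x+ε₂y}(∂_t − ε₁ cot t ∂_x + ε₂ tan t ∂_y)` is a Killing vector of
`g = diag(−1, sin²t, cos²t, 1)` on `0 < t < π/2`. -/
theorem stmt4 (ε₁ ε₂ : ℝ) (hε₁ : ε₁ = -1 ∨ ε₁ = 1) (hε₂ : ε₂ = -1 ∨ ε₂ = 1) :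
    ∀ (i j : Fin 4) (p : Fin 4 → ℝ), p 0 ∈ Set.Ioo 0 (π / 2) →
      (∑ k : Fin 4,
        (Ybar ε₁ ε₂ p k * pd k (fun q => gmet q i j) p
          + gmet p k j * pd i (fun q => Ybar ε₁ ε₂ q k) p
          + gmet p i k * pd j (fun q => Ybar ε₁ ε₂ q k) p)) = 0 := by
  intro i j p hp
  have hs : Real.sin (p 0) ≠ 0 :=
    (Real.sin_pos_of_pos_of_lt_pi hp.1 (by linarith [hp.1, hp.2, Real.pi_pos])).ne'
  have hc : Real.cos (p 0) ≠ 0 :=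
    (Real.cos_pos_of_mem_Ioo ⟨by linarith [hp.1, hp.2, Real.pi_pos], hp.2⟩).ne'
  have hsc := Real.sin_sq_add_cos_sq (p 0)
  have e1 : ε₁ ^ 2 = 1 := by rcases hε₁ with h | h <;> rw [h] <;> norm_num
  have e2 : ε₂ ^ 2 = 1 := by rcases hε₂ with h | h <;> rw [h] <;> norm_num
  have dcot : HasDerivAt (fun t => -(ε₁ * Real.cot t)) (ε₁ / Real.sin (p 0) ^ 2) (p 0) := by
    have := (((Real.hasDerivAt_cos (p 0)).div (Real.hasDerivAt_sin (p 0)) hs).const_mul ε₁).neg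
    refine (this.congr_deriv ?_).congr_of_eventuallyEq (Filter.Eventually.of_forall fun t => ?_)
    · field_simp
      linear_combination ε₁ * hsc
    · simp [Real.cot_eq_cos_div_sin]
  have dtan : HasDerivAt (fun t => ε₂ * Real.tan t) (ε₂ / Real.cos (p 0) ^ 2) (p 0) := by
    refine ((Real.hasDerivAt_tan hc).const_mul ε₂).congr_deriv ?_
    ring
  have Y0 (k : Fin 4) := pd_aux ε₁ ε₂ (fun _ => 1) 0 p (hasDerivAt_const _ _) k
  have Y1 (k : Fin 4) := pd_aux ε₁ ε₂ _ _ p dcot k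
  have Y2 (k : Fin 4) := pd_aux ε₁ ε₂ _ _ p dtan k
  have Y3 (k : Fin 4) := pd_aux ε₁ ε₂ (fun _ => 0) 0 p (hasDerivAt_const _ _) k
  have C (c : ℝ) (k : Fin 4) := pd_aux0 (fun _ => c) 0 p (hasDerivAt_const _ _) k
  have S (k : Fin 4) := pd_aux0 _ _ p ((Real.hasDerivAt_sin (p 0)).pow 2) k
  have K (k : Fin 4) := pd_aux0 _ _ p ((Real.hasDerivAt_cos (p 0)).pow 2) k
  simp only [Pi.pow_apply] at S K
  simp only [mul_one, mul_zero] at Y0 Y3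
  simp only [mul_neg] at Y1
  rw [Fin.sum_univ_four]
  fin_cases i <;> fin_cases j <;>
    simp [gmet, Ybar, Y0, Y1, Y2, Y3, C, S, K] <;>
    (try simp only [Real.tan_eq_sin_div_cos, Real.cot_eq_cos_div_sin]) <;>
    (try field_simp) <;> (try ring_nf) <;> (try simp only [e1, e2]) <;> (try ring_nf)
end

section
/- Consider on the region D = {(t,x,y,z) ∈ ℝ⁴ : 0 < t < π/2} the conformally flat Bianchi I metric g = diag(−1, sin²t, cos²t, 1). For each ε ∈ {−1, +1}: (i) the vector field C¹ with components e^{ε x}(cos t cos z, −ε cos z / sin t, 0, −sin t sin z) is a conformal Killing vector of g with conformal factor ψ¹ = −e^{ε x} sin t cos z, and (ii) the vector field C² with components e^{ε x}(cos t sin z, −ε sin z / sin t, 0, sin t cos z) is a conformal Killing vector of g with conformal factor ψ² = −e^{ε x} sin t sin z. -/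
open Real

/-- `C¹ = e^{εx}(cos t cos z ∂_t − ε (cos z / sin t) ∂_x − sin t sin z ∂_z)`. -/
noncomputable def C1 (ε : ℝ) (q : Fin 4 → ℝ) : Fin 4 → ℝ :=
  fun k => Real.exp (ε * q 1) *
    (![Real.cos (q 0) * Real.cos (q 3), -(ε * Real.cos (q 3) / Real.sin (q 0)), 0,
        -(Real.sin (q 0) * Real.sin (q 3))] : Fin 4 → ℝ) k

/-- `C² = e^{εx}(cos t sin z ∂_t − ε (sin z / sin t) ∂_x + sin t cos z ∂_z)`. -/
noncomputable def C2 (ε : ℝ) (q : Fin 4 → ℝ) : Fin 4 → ℝ :=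
  fun k => Real.exp (ε * q 1) *
    (![Real.cos (q 0) * Real.sin (q 3), -(ε * Real.sin (q 3) / Real.sin (q 0)), 0,
        Real.sin (q 0) * Real.cos (q 3)] : Fin 4 → ℝ) k

theorem pd_prod (k : Fin 4) (ε : ℝ) (a b : ℝ → ℝ) (a' b' : ℝ) (p : Fin 4 → ℝ)
    (ha : HasDerivAt a a' (p 0)) (hb : HasDerivAt b b' (p 3)) :
    pd k (fun q => Real.exp (ε * q 1) * (a (q 0) * b (q 3))) p =
      Real.exp (ε * p 1) * ((if k = 1 then ε * (a (p 0) * b (p 3)) else 0)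
        + (if k = 0 then a' * b (p 3) else 0) + (if k = 3 then a (p 0) * b' else 0)) := by
  have hq : ∀ m : Fin 4, HasFDerivAt (fun q : Fin 4 → ℝ => q m)
      (ContinuousLinearMap.proj (R := ℝ) (φ := fun _ : Fin 4 => ℝ) m) p :=
    fun m => hasFDerivAt_apply m p
  have h0 := ha.comp_hasFDerivAt p (hq 0)
  have h3 := hb.comp_hasFDerivAt p (hq 3)
  have h1 := ((hq 1).const_mul ε).exp
  have h := h1.mul (h0.mul h3)
  have h' : HasFDerivAt (fun q : Fin 4 → ℝ => Real.exp (ε * q 1) * (a (q 0) * b (q 3))) _ p := h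
  unfold pd
  rw [h'.fderiv]
  fin_cases k <;> simp <;> ring

theorem pd_g (k : Fin 4) (a : ℝ → ℝ) (a' : ℝ) (p : Fin 4 → ℝ) (ha : HasDerivAt a a' (p 0)) :
    pd k (fun q => a (q 0)) p = if k = 0 then a' else 0 := by
  have h := pd_prod k 0 a (fun _ => 1) a' 0 p ha (hasDerivAt_const _ _)
  simpa using h

theorem pd_gmet (k i j : Fin 4) (p : Fin 4 → ℝ) :
    pd k (fun q => gmet q i j) p = if k = 0 then (if i = j then
      (![(0 : ℝ), 2 * sin (p 0) * cos (p 0), -(2 * cos (p 0) * sin (p 0)), 0] : Fin 4 → ℝ) i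
      else 0) else 0 := by
  have hc : ∀ c : ℝ, pd k (fun _ => c) p = 0 := by intro c; simp [pd]
  by_cases hij : i = j
  · subst hij
    have h1 := pd_g k (fun t => sin t ^ 2) _ p ((hasDerivAt_sin (p 0)).pow 2)
    have h2 := pd_g k (fun t => cos t ^ 2) _ p ((hasDerivAt_cos (p 0)).pow 2)
    fin_cases i <;> simp [gmet, hc]
    · simpa using h1
    · simpa using h2
  · simp [gmet, hij, hc]

theorem hasD_inv (ε t : ℝ) (h : sin t ≠ 0) :
    HasDerivAt (fun t => -(ε / sin t)) (ε * cos t / sin t ^ 2) t := by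
  have := (((hasDerivAt_sin t).inv h).const_mul ε).neg
  have e1 : (fun t => -(ε / sin t)) = -fun y => ε * sin⁻¹ y := by
    funext x; simp [div_eq_mul_inv]
  have e2 : ε * cos t / sin t ^ 2 = -(ε * (-cos t / sin t ^ 2)) := by ring
  rw [e1, e2]
  exact this

theorem pd_C1 (k m : Fin 4) (ε : ℝ) (p : Fin 4 → ℝ) (h : sin (p 0) ≠ 0) :
    pd k (fun q => C1 ε q m) p = exp (ε * p 1) *
      (![![-sin (p 0) * cos (p 3), ε * (cos (p 0) * cos (p 3)), 0, -cos (p 0) * sin (p 3)],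
        ![ε * cos (p 0) / sin (p 0) ^ 2 * cos (p 3), -(ε * ε / sin (p 0) * cos (p 3)), 0,
          ε / sin (p 0) * sin (p 3)],
        ![0, 0, 0, 0],
        ![-cos (p 0) * sin (p 3), -(ε * (sin (p 0) * sin (p 3))), 0, -sin (p 0) * cos (p 3)]]
        : Fin 4 → Fin 4 → ℝ) m k := by
  have h0 := pd_prod k ε cos cos _ _ p (hasDerivAt_cos _) (hasDerivAt_cos _)
  have h1 := pd_prod k ε _ cos _ _ p (hasD_inv ε _ h) (hasDerivAt_cos _)
  have h3 := pd_prod k ε _ sin _ _ p (hasDerivAt_sin _).neg (hasDerivAt_sin _)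
  have e1 : (fun q => C1 ε q 1) = fun q : Fin 4 → ℝ =>
      exp (ε * q 1) * (-(ε / sin (q 0)) * cos (q 3)) := by
    funext q; simp [C1]; ring
  have e3 : (fun q => C1 ε q 3) = fun q : Fin 4 → ℝ =>
      exp (ε * q 1) * ((-sin) (q 0) * sin (q 3)) := by
    funext q; simp [C1]
  fin_cases m
  · refine h0.trans ?_
    fin_cases k <;> simp
  · refine (congrArg (fun f => pd k f p) e1).trans (h1.trans ?_)
    fin_cases k <;> simp <;> ring
  · fin_cases k <;> simp [C1, pd]
  · refine (congrArg (fun f => pd k f p) e3).trans (h3.trans ?_)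
    fin_cases k <;> simp

theorem pd_C2 (k m : Fin 4) (ε : ℝ) (p : Fin 4 → ℝ) (h : sin (p 0) ≠ 0) :
    pd k (fun q => C2 ε q m) p = exp (ε * p 1) *
      (![![-sin (p 0) * sin (p 3), ε * (cos (p 0) * sin (p 3)), 0, cos (p 0) * cos (p 3)],
        ![ε * cos (p 0) / sin (p 0) ^ 2 * sin (p 3), -(ε * ε / sin (p 0) * sin (p 3)), 0,
          -(ε / sin (p 0) * cos (p 3))],
        ![0, 0, 0, 0],
        ![cos (p 0) * cos (p 3), ε * (sin (p 0) * cos (p 3)), 0, -sin (p 0) * sin (p 3)]]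
        : Fin 4 → Fin 4 → ℝ) m k := by
  have h0 := pd_prod k ε cos sin _ _ p (hasDerivAt_cos _) (hasDerivAt_sin _)
  have h1 := pd_prod k ε _ sin _ _ p (hasD_inv ε _ h) (hasDerivAt_sin _)
  have h3 := pd_prod k ε sin cos _ _ p (hasDerivAt_sin _) (hasDerivAt_cos _)
  have e1 : (fun q => C2 ε q 1) = fun q : Fin 4 → ℝ =>
      exp (ε * q 1) * (-(ε / sin (q 0)) * sin (q 3)) := by
    funext q; simp [C2]; ring
  fin_cases m
  · refine h0.trans ?_
    fin_cases k <;> simp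
  · refine (congrArg (fun f => pd k f p) e1).trans (h1.trans ?_)
    fin_cases k <;> simp <;> ring
  · fin_cases k <;> simp [C2, pd]
  · refine h3.trans ?_
    fin_cases k <;> simp

/-- for each `ε ∈ {−1,+1}`, `C¹` is a CKV of `diag(−1, sin²t, cos²t, 1)` on
`0 < t < π/2` with conformal factor `ψ¹ = −e^{εx} sin t cos z`, and `C²` is a CKV with
conformal factor `ψ² = −e^{εx} sin t sin z`. -/
theorem stmt5 (ε : ℝ) (hε : ε = -1 ∨ ε = 1) :
    (∀ (i j : Fin 4) (p : Fin 4 → ℝ), p 0 ∈ Set.Ioo 0 (π / 2) →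
      (∑ k : Fin 4,
        (C1 ε p k * pd k (fun q => gmet q i j) p
          + gmet p k j * pd i (fun q => C1 ε q k) p
          + gmet p i k * pd j (fun q => C1 ε q k) p))
      = 2 * (-(Real.exp (ε * p 1) * Real.sin (p 0) * Real.cos (p 3))) * gmet p i j)
    ∧
    (∀ (i j : Fin 4) (p : Fin 4 → ℝ), p 0 ∈ Set.Ioo 0 (π / 2) →
      (∑ k : Fin 4,
        (C2 ε p k * pd k (fun q => gmet q i j) p
          + gmet p k j * pd i (fun q => C2 ε q k) p
          + gmet p i k * pd j (fun q => C2 ε q k) p))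
      = 2 * (-(Real.exp (ε * p 1) * Real.sin (p 0) * Real.sin (p 3))) * gmet p i j) := by
  have hee : ε ^ 2 = 1 := by rcases hε with h | h <;> rw [h] <;> norm_num
  have hs : ∀ p : Fin 4 → ℝ, p 0 ∈ Set.Ioo 0 (π / 2) → sin (p 0) ≠ 0 := fun p hp =>
    (sin_pos_of_pos_of_lt_pi hp.1 (by linarith [hp.2, pi_pos])).ne'
  constructor
  · intro i j p hp
    have h := hs p hp
    have hc : cos (p 0) ^ 2 = 1 - sin (p 0) ^ 2 := cos_sq' _
    simp only [pd_gmet, pd_C1 _ _ ε p h, Fin.sum_univ_four]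
    fin_cases i <;> fin_cases j <;> simp [gmet, C1] <;> field_simp <;> (try simp only [hee, hc]) <;>
      (try ring_nf) <;> (try simp only [hee, hc]) <;> (try ring_nf)
  · intro i j p hp
    have h := hs p hp
    have hc : cos (p 0) ^ 2 = 1 - sin (p 0) ^ 2 := cos_sq' _
    simp only [pd_gmet, pd_C2 _ _ ε p h, Fin.sum_univ_four]
    fin_cases i <;> fin_cases j <;> simp [gmet, C2] <;> field_simp <;> (try simp only [hee, hc]) <;>
      (try ring_nf) <;> (try simp only [hee, hc]) <;> (try ring_nf)
end
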